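/- Let K be a number field, let f(X) = X^d + a_{d−1}X^{d−1} + ⋯ + a_0 and g(X) = X^e + b_{e−1}X^{e−1} + ⋯ + b_0 be monic polynomials in K[X] with d = e + 1, set h = f/g, and let |·|_v be a non-archimedean absolute value on the algebraic closure of ℚ. If α is an algebraic number with |α|_v > max{1, |a_0|_v, …, |a_{d−1}|_v, |b_0|_v, …, |b_{e−1}|_v}, then the orbit α_0 = α, α_n = h(α_{n−1}) is well defined for all n (i.e. g(α_{n−1}) ≠ 0 for every n ≥ 1) and |α_n|_v = |α|_v for all n ≥ 1. -/

import Mathlib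

open Polynomial

theorem aux_eval {L : Type*} [Field L] (v : AbsoluteValue L ℝ)
    (hv : ∀ x y : L, v (x + y) ≤ max (v x) (v y)) (d : ℕ) (c : Fin d → L) (x : L)
    (h1 : 1 < v x) (hc : ∀ i, v (c i) < v x) :
    v ((X ^ d + ∑ i : Fin d, C (c i) * X ^ (i : ℕ) : Polynomial L).eval x) = v x ^ d := by
  have hpos : 0 < v x ^ d := by positivity
  have hsum : v (∑ i : Fin d, c i * x ^ (i : ℕ)) < v x ^ d := by
    refine Finset.sum_induction (fun i : Fin d => c i * x ^ (i : ℕ)) (fun y => v y < v x ^ d) ?_ ?_ ?_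
    · intro y z hy hz
      exact (hv y z).trans_lt (max_lt hy hz)
    · simpa using hpos
    · intro i _
      simp only [map_mul, map_pow]
      calc v (c i) * v x ^ (i : ℕ) < v x * v x ^ (i : ℕ) :=
            mul_lt_mul_of_pos_right (hc i) (by positivity)
        _ = v x ^ ((i : ℕ) + 1) := by ring
        _ ≤ v x ^ d := pow_le_pow_right₀ h1.le i.2
  simp only [eval_add, eval_pow, eval_X, eval_finset_sum, eval_mul, eval_C]
  set s := ∑ i : Fin d, c i * x ^ (i : ℕ)
  apply le_antisymm
  · refine (hv _ _).trans (max_le (by simp) hsum.le)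
  · by_contra! hlt
    have h := hv (x ^ d + s) (-s)
    rw [add_neg_cancel_right, map_pow, v.map_neg] at h
    exact absurd h (not_le.mpr (max_lt hlt hsum))

/-- Let `K` be a number field (a finite extension of `ℚ` inside the algebraic
closure `ℚ̄`), let `f(X) = X^d + a_{d-1}X^{d-1} + ⋯ + a_0` and
`g(X) = X^e + b_{e-1}X^{e-1} + ⋯ + b_0` be monic polynomials in `K[X]` with `d = e + 1`,
set `h = f/g`, and let `v` be a non-archimedean absolute value on `ℚ̄`.  If `α ∈ ℚ̄` satisfies
`|α|_v > max {1, |a_i|_v, |b_j|_v}`, then the orbit `α_0 = α`, `α_n = h(α_{n-1})` is well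
defined for all `n` (i.e. `g(α_{n-1}) ≠ 0` for every `n ≥ 1`) and `|α_n|_v = |α|_v` for all
`n ≥ 1`. -/
theorem roots_of_unity_orbits_stmt8
    (K : IntermediateField ℚ (AlgebraicClosure ℚ)) [FiniteDimensional ℚ K]
    (d e : ℕ) (hde : d = e + 1) (a : Fin d → K) (b : Fin e → K)
    (f g : Polynomial (AlgebraicClosure ℚ))
    (hf : f = X ^ d + ∑ i : Fin d, C ((a i : AlgebraicClosure ℚ)) * X ^ (i : ℕ))
    (hg : g = X ^ e + ∑ j : Fin e, C ((b j : AlgebraicClosure ℚ)) * X ^ (j : ℕ))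
    (v : AbsoluteValue (AlgebraicClosure ℚ) ℝ)
    (hv : ∀ x y : AlgebraicClosure ℚ, v (x + y) ≤ max (v x) (v y))
    (α : AlgebraicClosure ℚ)
    (hα1 : 1 < v α)
    (hαa : ∀ i : Fin d, v ((a i : AlgebraicClosure ℚ)) < v α)
    (hαb : ∀ j : Fin e, v ((b j : AlgebraicClosure ℚ)) < v α)
    (orb : ℕ → AlgebraicClosure ℚ)
    (horb : orb = fun n => (fun x => f.eval x / g.eval x)^[n] α) :
    (∀ n : ℕ, g.eval (orb n) ≠ 0) ∧ ∀ n : ℕ, 1 ≤ n → v (orb n) = v α := by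
  have key : ∀ n, v (orb n) = v α := by
    intro n
    induction n with
    | zero => simp [horb]
    | succ n ih =>
      have hs : orb (n + 1) = f.eval (orb n) / g.eval (orb n) := by
        rw [horb]; exact Function.iterate_succ_apply' _ _ _
      have hF := aux_eval v hv d (fun i => (a i : AlgebraicClosure ℚ)) (orb n)
        (by rw [ih]; exact hα1) (by rw [ih]; exact hαa)
      have hG := aux_eval v hv e (fun i => (b i : AlgebraicClosure ℚ)) (orb n)
        (by rw [ih]; exact hα1) (by rw [ih]; exact hαb)
      rw [← hf] at hF
      rw [← hg] at hG
      have h0 : v α ≠ 0 := by positivity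
      rw [hs, map_div₀, hF, hG, ih, hde, pow_succ]
      field_simp
  refine ⟨fun n h => ?_, fun n _ => key n⟩
  have hG := aux_eval v hv e (fun i => (b i : AlgebraicClosure ℚ)) (orb n)
    (by rw [key]; exact hα1) (by rw [key]; exact hαb)
  rw [← hg, h, key, map_zero] at hG
  have : 0 < v α ^ e := by positivity
  exact this.ne hG
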